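/- Let H be a finite graph and let 𝒢 be a class of finite graphs closed under taking subgraphs such that every graph in 𝒢 is H-minor-free. Let d > 0 be a real number and suppose there is a function g : ℕ → ℝ with g(n)/n → 0 as n → ∞ such that |E(G)| ≤ d·|V(G)| + g(|V(G)|) for every G ∈ 𝒢. Then there exists an integer C ≥ 1 such that every non-empty graph in 𝒢 contains a ⌊d+1⌋-island of size at most C; that is, col_⋆(𝒢) ≤ ⌊d+1⌋. -/

import Mathlib

open SimpleGraph

/-- `S` is a `t`-island in `G`: a nonempty set of vertices each of which has
fewer than `t` neighbors outside `S`. -/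
def IsIsland {V : Type*} (G : SimpleGraph V) (t : ℕ) (S : Set V) : Prop :=
  S.Nonempty ∧ ∀ v ∈ S, ((G.neighborSet v) \ S).ncard < t

/-- `H` is a minor of `G`: there is a model of `H` in `G`. -/
def IsMinorOf {W V : Type*} (H : SimpleGraph W) (G : SimpleGraph V) : Prop :=
  ∃ μ : W → Set V,
    (∀ w, (μ w).Nonempty) ∧
    (∀ w, (G.induce (μ w)).Connected) ∧
    (Pairwise fun w₁ w₂ => Disjoint (μ w₁) (μ w₂)) ∧
    (∀ ⦃w₁ w₂⦄, H.Adj w₁ w₂ → ∃ u ∈ μ w₁, ∃ v ∈ μ w₂, G.Adj u v)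

/-- The graph `I_n + P_m`: a path on `m` vertices together with `n` additional
pairwise non-adjacent vertices, each adjacent to every vertex of the path. -/
def IplusP (n m : ℕ) : SimpleGraph (Fin n ⊕ Fin m) :=
  SimpleGraph.fromRel (fun a b =>
    (∃ i j, a = Sum.inl i ∧ b = Sum.inr j) ∨
    (∃ i j : Fin m, a = Sum.inr i ∧ b = Sum.inr j ∧ (i : ℕ) + 1 = (j : ℕ)))

/-- `c` is a coloring of `G` with clustering `C`: every monochromatic connected
subgraph has at most `C` vertices. -/
def ClusteredColoring {V α : Type*} (G : SimpleGraph V) (C : ℕ) (c : V → α) : Prop :=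
  ∀ S : Set V, (G.induce S).Connected → (∀ u ∈ S, ∀ v ∈ S, c u = c v) → S.ncard ≤ C

/-- `G` has a tree decomposition of width at most `w`. -/
def HasTreewidthAtMost {V : Type*} (G : SimpleGraph V) (w : ℕ) : Prop :=
  ∃ (n : ℕ) (T : SimpleGraph (Fin n)) (β : Fin n → Set V), T.IsTree ∧
    (∀ ⦃u v⦄, G.Adj u v → ∃ x, u ∈ β x ∧ v ∈ β x) ∧
    (∀ v : V, (T.induce {x | v ∈ β x}).Connected) ∧
    (∀ x, (β x).ncard ≤ w + 1)

/-- A class of graphs, given for each `n` as a collection of graphs on `Fin n`. -/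
def MemClass (𝒢 : ∀ n : ℕ, SimpleGraph (Fin n) → Prop) {V : Type*} (G : SimpleGraph V) : Prop :=
  ∃ (n : ℕ) (G' : SimpleGraph (Fin n)), 𝒢 n G' ∧ Nonempty (G ≃g G')

/-- `𝒢` is a (proper) minor-closed class. -/
def MinorClosed (𝒢 : ∀ n : ℕ, SimpleGraph (Fin n) → Prop) : Prop :=
  (∃ (n : ℕ) (G : SimpleGraph (Fin n)), ¬ 𝒢 n G) ∧
  ∀ ⦃n k : ℕ⦄ (G : SimpleGraph (Fin n)) (H : SimpleGraph (Fin k)),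
    𝒢 n G → IsMinorOf H G → 𝒢 k H

/-- `𝒢` is closed under taking subgraphs (up to isomorphism). -/
def SubgraphClosed (𝒢 : ∀ n : ℕ, SimpleGraph (Fin n) → Prop) : Prop :=
  ∀ ⦃n k : ℕ⦄ (G : SimpleGraph (Fin n)) (H : SimpleGraph (Fin k)), 𝒢 n G →
    (∃ f : Fin k → Fin n, Function.Injective f ∧ ∀ ⦃a b⦄, H.Adj a b → G.Adj (f a) (f b)) →
    𝒢 k H

/-- The vertices that eventually become active in bootstrap `t`-percolation
starting from the active set `A`. -/
inductive PercolationActive {V : Type*} (G : SimpleGraph V) (t : ℕ) (A : Set V) : V → Prop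
  | base (v : V) : v ∈ A → PercolationActive G t A v
  | step (v : V) (N : Finset V) : t ≤ N.card → (∀ u ∈ N, G.Adj v u) →
      (∀ u ∈ N, PercolationActive G t A u) → PercolationActive G t A v

/-- The set `A` `t`-percolates in `G`. -/
def Percolates {V : Type*} (G : SimpleGraph V) (t : ℕ) (A : Set V) : Prop :=
  ∀ v, PercolationActive G t A v

/-- `G` contains `k` pairwise disjoint `t`-islands. -/
def HasDisjointIslands {V : Type*} (G : SimpleGraph V) (t k : ℕ) : Prop :=
  ∃ f : Fin k → Set V, (∀ i, IsIsland G t (f i)) ∧ Pairwise (Function.onFun Disjoint f)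

/-- `f` is significantly sublinear: `∑ f(⌈(3/2)^i⌉)/(3/2)^i` is finite. -/
def SignificantlySublinear (f : ℕ → ℕ) : Prop :=
  Summable (fun i : ℕ => (f ⌈((3:ℝ)/2)^i⌉₊ : ℝ) / ((3:ℝ)/2)^i)

/-- The class `𝒢` has `f`-separators. -/
def HasSeparators (f : ℕ → ℕ) (𝒢 : ∀ n : ℕ, SimpleGraph (Fin n) → Prop) : Prop :=
  ∀ (n : ℕ) (G : SimpleGraph (Fin n)), 𝒢 n G →
    ∃ L R : G.Subgraph, L ⊔ R = ⊤ ∧ (L.verts ∩ R.verts).ncard ≤ f n ∧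
      3 * (L.verts \ R.verts).ncard ≤ 2 * n ∧ 3 * (R.verts \ L.verts).ncard ≤ 2 * n

/-- The number of edges of `G` with at least one end in `A`. -/
noncomputable def edgesTouching {V : Type*} (G : SimpleGraph V) (A : Set V) : ℕ :=
  {e ∈ G.edgeSet | ∃ v ∈ A, v ∈ e}.ncard

section Near

variable {V : Type*}

/-- `u` and `v` are at distance at most `k` in `G`. -/
def Near (G : SimpleGraph V) (k : ℕ) (u v : V) : Prop :=
  ∃ w : G.Walk u v, w.length ≤ k

theorem Near.refl (G : SimpleGraph V) (k : ℕ) (u : V) : Near G k u u :=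
  ⟨.nil, Nat.zero_le _⟩

theorem Near.symm {G : SimpleGraph V} {k : ℕ} {u v : V} (h : Near G k u v) : Near G k v u := by
  obtain ⟨w, hw⟩ := h
  exact ⟨w.reverse, by simpa using hw⟩

theorem Near.trans {G : SimpleGraph V} {k l : ℕ} {u v w : V} (h : Near G k u v)
    (h' : Near G l v w) : Near G (k + l) u w := by
  obtain ⟨p, hp⟩ := h
  obtain ⟨q, hq⟩ := h'
  exact ⟨p.append q, by rw [SimpleGraph.Walk.length_append]; omega⟩

theorem Near.mono {G G' : SimpleGraph V} (hG : G ≤ G') {k l : ℕ} (hk : k ≤ l) {u v : V}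
    (h : Near G k u v) : Near G' l u v := by
  obtain ⟨p, hp⟩ := h
  exact ⟨p.mapLe hG, by simpa using hp.trans hk⟩

theorem SimpleGraph.Adj.near {G : SimpleGraph V} {u v : V} (h : G.Adj u v) : Near G 1 u v :=
  ⟨h.toWalk, by simp⟩

theorem Near.le_add_of_adj {G : SimpleGraph V} {L : V → ℕ}
    (hL : ∀ u v, G.Adj u v → L u ≤ L v + 1) {k : ℕ} {u v : V} (h : Near G k u v) :
    L u ≤ L v + k := by
  obtain ⟨p, hp⟩ := h
  induction p generalizing k with
  | nil => omega
  | cons hadj q ih =>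
    rw [SimpleGraph.Walk.length_cons] at hp
    have h1 := ih (k := k - 1) (by omega)
    have h2 := hL _ _ hadj
    omega

end Near

section Linked

variable {V : Type*}

/-- Any two vertices of the nonempty set `S` are joined by a walk of `G` inside `S`. -/
def Linked (G : SimpleGraph V) (S : Set V) : Prop :=
  S.Nonempty ∧ ∀ u ∈ S, ∀ v ∈ S,
    Relation.ReflTransGen (fun a b => G.Adj a b ∧ a ∈ S ∧ b ∈ S) u v

theorem reflTransGen_adj_symm {G : SimpleGraph V} {S : Set V} {u v : V}
    (h : Relation.ReflTransGen (fun a b => G.Adj a b ∧ a ∈ S ∧ b ∈ S) u v) :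
    Relation.ReflTransGen (fun a b => G.Adj a b ∧ a ∈ S ∧ b ∈ S) v u := by
  induction h with
  | refl => exact .refl
  | tail _ hab ih => exact .head ⟨hab.1.symm, hab.2.2, hab.2.1⟩ ih

theorem reflTransGen_adj_mono {G : SimpleGraph V} {S T : Set V} (hST : S ⊆ T) {u v : V}
    (h : Relation.ReflTransGen (fun a b => G.Adj a b ∧ a ∈ S ∧ b ∈ S) u v) :
    Relation.ReflTransGen (fun a b => G.Adj a b ∧ a ∈ T ∧ b ∈ T) u v :=
  Relation.ReflTransGen.mono (fun _ _ hab => ⟨hab.1, hST hab.2.1, hST hab.2.2⟩) _ _ h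

theorem linked_of_center {G : SimpleGraph V} {S : Set V} {c : V} (hc : c ∈ S)
    (h : ∀ v ∈ S, Relation.ReflTransGen (fun a b => G.Adj a b ∧ a ∈ S ∧ b ∈ S) c v) :
    Linked G S :=
  ⟨⟨c, hc⟩, fun u hu v hv => (reflTransGen_adj_symm (h u hu)).trans (h v hv)⟩

theorem Linked.mono {G G' : SimpleGraph V} (hG : G ≤ G') {S : Set V} (h : Linked G S) :
    Linked G' S :=
  ⟨h.1, fun u hu v hv => Relation.ReflTransGen.mono
    (fun _ _ hab => ⟨hG hab.1, hab.2⟩) _ _ (h.2 u hu v hv)⟩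

theorem Linked.induce_connected {G : SimpleGraph V} {S : Set V} (h : Linked G S) :
    (G.induce S).Connected := by
  obtain ⟨⟨c, hc⟩, h⟩ := h
  rw [SimpleGraph.connected_iff_exists_forall_reachable]
  refine ⟨⟨c, hc⟩, fun ⟨v, hv⟩ => ?_⟩
  have key : ∀ w, Relation.ReflTransGen (fun a b => G.Adj a b ∧ a ∈ S ∧ b ∈ S) c w →
      ∀ hw : w ∈ S, (G.induce S).Reachable ⟨c, hc⟩ ⟨w, hw⟩ := by
    intro w hcw
    induction hcw with
    | refl => exact fun _ => SimpleGraph.Reachable.refl _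
    | tail _ hab ih =>
      intro hw
      exact (ih hab.2.1).trans (SimpleGraph.Adj.reachable (by simpa using hab.1))
  exact key v (h c hc v hv) hv

theorem Linked.union {G : SimpleGraph V} {S T : Set V} (hS : Linked G S) (hT : Linked G T)
    {u v : V} (hu : u ∈ S) (hv : v ∈ T) (huv : G.Adj u v) : Linked G (S ∪ T) := by
  refine linked_of_center (c := u) (Or.inl hu) ?_
  rintro w (hw | hw)
  · exact reflTransGen_adj_mono Set.subset_union_left (hS.2 u hu w hw)
  · exact .head ⟨huv, Or.inl hu, Or.inr hv⟩
      (reflTransGen_adj_mono Set.subset_union_right (hT.2 v hv w hw))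

end Linked

section Chop

variable {V : Type*}

/-- `L` is the distance function of a breadth-first search forest of `G` in which every non-root
`v` has parent `p v` and every root is its own parent. -/
structure IsLayering (G : SimpleGraph V) (L : V → ℕ) (p : V → V) : Prop where
  adj_parent : ∀ v, L v ≠ 0 → G.Adj (p v) v
  level_parent : ∀ v, L (p v) = L v - 1
  parent_root : ∀ v, L v = 0 → p v = v
  root_unique : ∀ u v, G.Reachable u v → L u = 0 → L v = 0 → u = v
  level_le : ∀ u v, G.Adj u v → L u ≤ L v + 1

/-- `G'` arises from `G` by cutting a breadth-first search layering of `G` into bands of `ℓ`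
consecutive layers. -/
def IsChop (ℓ : ℕ) (G G' : SimpleGraph V) : Prop :=
  ∃ (L : V → ℕ) (p : V → V) (s : ℕ), IsLayering G L p ∧
    ∀ u v, G'.Adj u v ↔ G.Adj u v ∧ (L u + s) / ℓ = (L v + s) / ℓ

theorem IsChop.le {ℓ : ℕ} {G G' : SimpleGraph V} (h : IsChop ℓ G G') : G' ≤ G := by
  obtain ⟨L, p, s, -, h⟩ := h
  exact fun u v huv => ((h u v).1 huv).1

namespace IsLayering

variable {G : SimpleGraph V} {L : V → ℕ} {p : V → V}

theorem level_iterate (h : IsLayering G L p) (k : ℕ) (v : V) : L (p^[k] v) = L v - k := by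
  induction k with
  | zero => rfl
  | succ k ih => rw [Function.iterate_succ_apply', h.level_parent, ih]; omega

theorem near_iterate (h : IsLayering G L p) (k : ℕ) (v : V) : Near G k v (p^[k] v) := by
  induction k with
  | zero => exact Near.refl _ _ _
  | succ k ih =>
    rw [Function.iterate_succ_apply']
    by_cases h0 : L (p^[k] v) = 0
    · rw [h.parent_root _ h0]; exact ih.mono le_rfl (Nat.le_succ k)
    · exact ih.trans (h.adj_parent _ h0).symm.near

theorem reachable_iterate (h : IsLayering G L p) (k : ℕ) (v : V) : G.Reachable v (p^[k] v) :=
  let ⟨w, _⟩ := h.near_iterate k v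
  ⟨w⟩

theorem near_of_reachable (h : IsLayering G L p) {u v : V} (huv : G.Reachable u v) :
    Near G (L u + L v) u v := by
  have h1 := h.near_iterate (L u) u
  have h2 := h.near_iterate (L v) v
  have : p^[L u] u = p^[L v] v := by
    apply h.root_unique
    · exact ((h.reachable_iterate _ _).symm.trans huv).trans (h.reachable_iterate _ _)
    · rw [h.level_iterate]; omega
    · rw [h.level_iterate]; omega
  rw [← this] at h2
  exact h1.trans h2.symm

/-- A union of ancestor chains in one component, closed under taking parents, is connected. -/
theorem linked_of_closed (h : IsLayering G L p) {S : Set V} (hne : S.Nonempty)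
    (hS : ∀ v ∈ S, p v ∈ S) (hr : ∀ u ∈ S, ∀ v ∈ S, G.Reachable u v) : Linked G S := by
  obtain ⟨c, hc⟩ := hne
  have hit : ∀ k, ∀ v ∈ S, p^[k] v ∈ S ∧
      Relation.ReflTransGen (fun a b => G.Adj a b ∧ a ∈ S ∧ b ∈ S) v (p^[k] v) := by
    intro k v hv
    induction k with
    | zero => exact ⟨hv, .refl⟩
    | succ k ih =>
      rw [Function.iterate_succ_apply']
      refine ⟨hS _ ih.1, ?_⟩
      by_cases h0 : L (p^[k] v) = 0
      · rw [h.parent_root _ h0]; exact ih.2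
      · exact ih.2.tail ⟨(h.adj_parent _ h0).symm, ih.1, hS _ ih.1⟩
  have hroot : ∀ v ∈ S, p^[L v] v = p^[L c] c := by
    intro v hv
    apply h.root_unique
    · exact hr _ (hit _ v hv).1 _ (hit _ c hc).1
    · rw [h.level_iterate]; omega
    · rw [h.level_iterate]; omega
  refine linked_of_center (hit (L c) c hc).1 fun v hv => ?_
  rw [← hroot v hv]
  exact reflTransGen_adj_symm (hit (L v) v hv).2

end IsLayering

/-- A model of a complete bipartite graph in `G` with `r` parts on one side and parts `S i` close
to `x i` on the other, where each `S i` has a vertex far in `G'` from the first side. -/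
def HasAnchoredModel {ι : Type*} (G G' : SimpleGraph V) (x : ι → V) (ℓ r c : ℕ) : Prop :=
  ∃ (A : Fin r → Set V) (S : ι → Set V) (m : ι → V),
    (∀ a, Linked G (A a)) ∧ (∀ i, Linked G (S i)) ∧
    (Pairwise fun a b => Disjoint (A a) (A b)) ∧
    (∀ a i, Disjoint (A a) (S i)) ∧
    (∀ a i, ∃ u ∈ A a, ∃ v ∈ S i, G.Adj u v) ∧
    (∀ i, m i ∈ S i) ∧
    (∀ i, ∀ v ∈ S i, Near G c (x i) v) ∧
    (∀ a, ∀ v ∈ A a, ∀ i, G'.Reachable (x i) v) ∧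
    (∀ i, ∀ v ∈ S i, G'.Reachable (x i) v) ∧
    (∀ a i, ∀ v ∈ A a, ¬ Near G' ℓ (m i) v)

theorem hasAnchoredModel_zero {ι : Type*} (G G' : SimpleGraph V) (x : ι → V) (ℓ : ℕ) :
    HasAnchoredModel G G' x ℓ 0 0 := by
  refine ⟨fun a => a.elim0, fun i => {x i}, x, fun a => a.elim0, ?_, fun a => a.elim0,
    fun a => a.elim0, fun a => a.elim0, fun i => rfl, ?_, fun a => a.elim0, ?_, fun a => a.elim0⟩
  · rintro i
    refine linked_of_center (c := x i) rfl ?_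
    rintro v rfl
    exact .refl
  · rintro i v rfl
    exact Near.refl _ _ _
  · rintro i v rfl
    exact SimpleGraph.Reachable.refl _

theorem HasAnchoredModel.of_isChop {ι : Type*} {G G₁ G₂ : SimpleGraph V} {x : ι → V}
    {ℓ r c : ℕ} (hℓ : 0 < ℓ) (hchop : IsChop ℓ G₁ G₂) (hG : G₁ ≤ G)
    (hx : ∀ i j, G₂.Reachable (x i) (x j)) {i₀ j₀ : ι} (hfar : ¬ Near G (14 * ℓ) (x i₀) (x j₀))
    (h : HasAnchoredModel G G₂ x ℓ r c) : HasAnchoredModel G G₁ x ℓ (r + 1) (c + 6 * ℓ) := by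
  have hG21 : G₂ ≤ G₁ := hchop.le
  obtain ⟨L, p, s, hL, hG₂⟩ := hchop
  obtain ⟨A, S, m, hA, hS, hAA, hAS, hadj, hm, hnear, hAr, hSr, hAm⟩ := h
  have hband : ∀ u v, G₂.Reachable u v → (L u + s) / ℓ = (L v + s) / ℓ := by
    rintro u v ⟨w⟩
    induction w with
    | nil => rfl
    | cons h _ ih => exact ((hG₂ _ _).1 h).2.trans ih
  -- the band containing the `x i` spans the layers from `a` to `a + ℓ - 1`
  obtain ⟨a, ha, hlev⟩ : ∃ a, 6 * ℓ < a ∧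
      ∀ v, G₂.Reachable (x i₀) v → a ≤ L v ∧ L v < a + ℓ ∧
        ∀ w, a ≤ L w → L w < a + ℓ → (L v + s) / ℓ = (L w + s) / ℓ := by
    set b := (L (x i₀) + s) / ℓ with hb
    have hbd : ∀ v, G₂.Reachable (x i₀) v → b * ℓ ≤ L v + s ∧ L v + s < (b + 1) * ℓ := by
      intro v hv
      have := hband _ _ hv
      rw [← hb, eq_comm, Nat.div_eq_iff hℓ] at this
      rw [Nat.succ_mul]; omega
    have hbig : 7 * ℓ ≤ L (x i₀) ∨ 7 * ℓ ≤ L (x j₀) := by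
      by_contra! hcon
      exact hfar ((hL.near_of_reachable ((hx i₀ j₀).mono hG21)).mono hG (by omega))
    have hi := hbd _ (hx i₀ i₀)
    have hj := hbd _ (hx i₀ j₀)
    rw [Nat.succ_mul] at hi hj
    refine ⟨b * ℓ - s, by omega, fun v hv => ?_⟩
    have hv' := hbd v hv
    rw [Nat.succ_mul] at hv'
    refine ⟨by omega, by omega, fun w hw hw' => ?_⟩
    rw [← hband _ _ hv, ← hb, eq_comm, Nat.div_eq_iff hℓ]
    omega
  have hx' : ∀ i v, G₂.Reachable (x i) v → G₂.Reachable (x i₀) v := fun i v h => (hx i₀ i).trans h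
  have hmr : ∀ i, G₂.Reachable (x i₀) (m i) := fun i => hx' i _ (hSr i _ (hm i))
  have hma : ∀ i, a ≤ L (m i) ∧ L (m i) < a + ℓ := fun i =>
    ⟨(hlev _ (hmr i)).1, (hlev _ (hmr i)).2.1⟩
  have hAl : ∀ b, ∀ v ∈ A b, a ≤ L v := fun b v hv => (hlev v (hAr b v hv i₀)).1
  have hSl : ∀ i, ∀ v ∈ S i, a ≤ L v := fun i v hv => (hlev v (hx' i _ (hSr i v hv))).1
  -- the part of the path from `m i` to the root that stays inside the band
  have hpath : ∀ i k, k ≤ L (m i) - a → Near G₂ k (m i) (p^[k] (m i)) := by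
    intro i k
    induction k with
    | zero => exact fun _ => Near.refl _ _ _
    | succ k ih =>
      intro hk
      refine (ih (by omega)).trans (SimpleGraph.Adj.near ?_)
      have h1 := hL.level_iterate k (m i)
      have h2 := hL.level_iterate (k + 1) (m i)
      have hmi := hma i
      rw [hG₂]
      constructor
      · rw [Function.iterate_succ_apply']
        exact (hL.adj_parent _ (by omega)).symm
      · exact ((hlev _ (hmr i)).2.2 _ (by omega) (by omega)).symm.trans
          ((hlev _ (hmr i)).2.2 _ (by omega) (by omega))
  have hr1 : ∀ i k, G₁.Reachable (x i₀) (p^[k] (m i)) := fun i k =>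
    ((hmr i).mono hG21).trans (hL.reachable_iterate k (m i))
  let Q : ι → Set V := fun i => {v | ∃ k, k ≤ L (m i) - a + 4 * ℓ ∧ p^[k] (m i) = v}
  let B : Set V := {v | ∃ i k, L (m i) - a + 4 * ℓ < k ∧ p^[k] (m i) = v}
  have hQl : ∀ i, ∀ v ∈ Q i, a ≤ L v + 4 * ℓ := by
    rintro i v ⟨k, hk, rfl⟩
    have := hma i
    rw [hL.level_iterate]; omega
  have hBl : ∀ v ∈ B, L v + 4 * ℓ < a := by
    rintro v ⟨i, k, hk, rfl⟩
    have := hma i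
    rw [hL.level_iterate]; omega
  have hAQ : ∀ b i, Disjoint (A b) (Q i) := by
    intro b i
    rw [Set.disjoint_left]
    rintro v hv ⟨k, hk, rfl⟩
    have hmi := hma i
    by_cases hk' : k ≤ L (m i) - a
    · exact hAm b i _ hv ((hpath i k hk').mono le_rfl (by omega))
    · have := hAl b _ hv
      rw [hL.level_iterate] at this
      omega
  have hBA : ∀ b, Disjoint B (A b) := by
    intro b
    rw [Set.disjoint_left]
    intro v hv hv'
    have := hBl v hv
    have := hAl b v hv'
    omega
  have hlevel : ∀ {k u v}, Near G₁ k u v → L u ≤ L v + k ∧ L v ≤ L u + k := fun h =>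
    ⟨h.le_add_of_adj hL.level_le, h.symm.le_add_of_adj hL.level_le⟩
  refine ⟨Fin.cons B A, fun i => S i ∪ Q i, fun i => p^[L (m i) - a + 2 * ℓ] (m i),
    ?_, ?_, ?_, ?_, ?_, ?_, ?_, ?_, ?_, ?_⟩
  · refine Fin.cases ?_ hA
    refine Linked.mono hG (hL.linked_of_closed ⟨_, i₀, _, Nat.lt_succ_self _, rfl⟩ ?_ ?_)
    · rintro v ⟨i, k, hk, rfl⟩
      exact ⟨i, k + 1, by omega, Function.iterate_succ_apply' _ _ _⟩
    · rintro u ⟨i, k, hk, rfl⟩ v ⟨j, k', hk', rfl⟩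
      exact (hr1 i k).symm.trans (hr1 j k')
  · intro i
    refine linked_of_center (c := m i) (Or.inl (hm i)) ?_
    rintro v (hv | ⟨k, hk, rfl⟩)
    · exact reflTransGen_adj_mono Set.subset_union_left ((hS i).2 _ (hm i) v hv)
    · induction k with
      | zero => exact .refl
      | succ k ih =>
        refine (ih (by omega)).tail ⟨?_, Or.inr ⟨k, by omega, rfl⟩, Or.inr ⟨k + 1, hk, rfl⟩⟩
        have hmi := hma i
        have := hL.level_iterate k (m i)
        rw [Function.iterate_succ_apply']
        exact hG (hL.adj_parent _ (by omega)).symm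
  · intro b₁ b₂
    refine Fin.cases ?_ (fun b₁ => ?_) b₁ <;> refine Fin.cases ?_ (fun b₂ => ?_) b₂
    · exact fun h => absurd rfl h
    · exact fun _ => hBA b₂
    · exact fun _ => (hBA b₁).symm
    · exact fun h => hAA fun h' => h (congrArg _ h')
  · intro b i
    refine Fin.cases ?_ (fun b => ?_) b
    · rw [Set.disjoint_left]
      rintro v hv (hv' | hv')
      · have := hBl v hv
        have := hSl i v hv'
        omega
      · have := hBl v hv
        have := hQl i v hv'
        omega
    · exact Set.disjoint_union_right.2 ⟨hAS b i, hAQ b i⟩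
  · intro b i
    refine Fin.cases ?_ (fun b => ?_) b
    · refine ⟨p^[L (m i) - a + 4 * ℓ + 1] (m i), ⟨i, _, Nat.lt_succ_self _, rfl⟩,
        p^[L (m i) - a + 4 * ℓ] (m i), Or.inr ⟨_, le_rfl, rfl⟩, ?_⟩
      have hmi := hma i
      have := hL.level_iterate (L (m i) - a + 4 * ℓ) (m i)
      rw [Function.iterate_succ_apply']
      exact hG (hL.adj_parent _ (by omega))
    · obtain ⟨u, hu, v, hv, huv⟩ := hadj b i
      exact ⟨u, hu, v, Or.inl hv, huv⟩
  · exact fun i => Or.inr ⟨_, by omega, rfl⟩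
  · rintro i v (hv | ⟨k, hk, rfl⟩)
    · exact (hnear i v hv).mono le_rfl (by omega)
    · have hmi := hma i
      exact ((hnear i _ (hm i)).trans ((hL.near_iterate k (m i)).mono hG le_rfl)).mono le_rfl
        (by omega)
  · refine Fin.cases ?_ (fun b v hv i => (hAr b v hv i).mono hG21)
    rintro v ⟨j, k, hk, rfl⟩ i
    exact ((hx i i₀).mono hG21).trans (hr1 j k)
  · rintro i v (hv | ⟨k, hk, rfl⟩)
    · exact (hSr i v hv).mono hG21
    · exact ((hx i i₀).mono hG21).trans (hr1 i k)
  · intro b i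
    have hmi := hma i
    have hl := hL.level_iterate (L (m i) - a + 2 * ℓ) (m i)
    refine Fin.cases ?_ (fun b => ?_) b
    · intro v hv hn
      have := hBl v hv
      have := hlevel hn
      simp only [hl] at this
      omega
    · intro v hv hn
      have := hAl b v hv
      have := hlevel hn
      simp only [hl] at this
      omega

/-- `G'` arises from `G` by `r` successive chops. -/
inductive IsIteratedChop (ℓ : ℕ) : ℕ → SimpleGraph V → SimpleGraph V → Prop
  | zero (G : SimpleGraph V) : IsIteratedChop ℓ 0 G G
  | succ {r : ℕ} {G G₁ G₂ : SimpleGraph V} : IsChop ℓ G G₁ → IsIteratedChop ℓ r G₁ G₂ →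
      IsIteratedChop ℓ (r + 1) G G₂

theorem IsIteratedChop.le {ℓ r : ℕ} {G G' : SimpleGraph V} (h : IsIteratedChop ℓ r G G') :
    G' ≤ G := by
  induction h with
  | zero => exact le_rfl
  | succ h _ ih => exact ih.trans h.le

theorem IsIteratedChop.hasAnchoredModel {ι : Type*} {G G₁ G₂ : SimpleGraph V} {x : ι → V}
    {ℓ r : ℕ} (hℓ : 0 < ℓ) (hchop : IsIteratedChop ℓ r G₁ G₂) (hG : G₁ ≤ G)
    (hx : ∀ i j, G₂.Reachable (x i) (x j)) {i₀ j₀ : ι}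
    (hfar : ¬ Near G (14 * ℓ) (x i₀) (x j₀)) : HasAnchoredModel G G₁ x ℓ r (r * (6 * ℓ)) := by
  induction hchop with
  | zero => simpa using hasAnchoredModel_zero G _ x ℓ
  | succ h h' ih =>
    rw [Nat.succ_mul]
    exact (ih (h.le.trans hG) hx).of_isChop hℓ h hG
      (fun i j => (hx i j).mono h'.le) hfar

theorem HasAnchoredModel.isMinorOf {W : Type*} {G G' : SimpleGraph V} {ι : Type*} {x : ι → V}
    {ℓ r c : ℕ} (h : HasAnchoredModel G G' x ℓ r c)
    (hfar : ∀ i j, i ≠ j → ¬ Near G (c + c) (x i) (x j))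
    (H : SimpleGraph W) (f : W → Fin r) (hf : f.Injective) (f' : W → ι) (hf' : f'.Injective) :
    IsMinorOf H G := by
  obtain ⟨A, S, m, hA, hS, hAA, hAS, hadj, hm, hnear, -⟩ := h
  refine ⟨fun w => A (f w) ∪ S (f' w), ?_, ?_, ?_, ?_⟩
  · exact fun w => ⟨_, Or.inr (hm _)⟩
  · intro w
    obtain ⟨u, hu, v, hv, huv⟩ := hadj (f w) (f' w)
    exact ((hA _).union (hS _) hu hv huv).induce_connected
  · intro w₁ w₂ hw
    rw [Set.disjoint_union_left, Set.disjoint_union_right, Set.disjoint_union_right]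
    refine ⟨⟨hAA (hf.ne hw), hAS _ _⟩, (hAS _ _).symm, ?_⟩
    rw [Set.disjoint_left]
    exact fun v hv hv' => hfar _ _ (hf'.ne hw) ((hnear _ v hv).trans (hnear _ v hv').symm)
  · intro w₁ w₂ _
    obtain ⟨u, hu, v, hv, huv⟩ := hadj (f w₁) (f' w₂)
    exact ⟨u, Or.inl hu, v, Or.inr hv, huv⟩

end Chop

section Decomposition

open Finset

variable {V : Type*}

theorem exists_isLayering (G : SimpleGraph V) : ∃ L p, IsLayering G L p := by
  classical
  let ρ : V → V := fun v => (G.connectedComponentMk v).out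
  have hρ : ∀ v, G.Reachable (ρ v) v := fun v =>
    SimpleGraph.ConnectedComponent.exact (Quot.out_eq (G.connectedComponentMk v))
  have hρe : ∀ u v, G.Reachable u v → ρ u = ρ v := fun u v h =>
    congrArg Quot.out (SimpleGraph.ConnectedComponent.sound h)
  have hadj : ∀ u v, G.Adj u v → G.dist (ρ u) u ≤ G.dist (ρ v) v + 1 := by
    intro u v huv
    rw [hρe u v huv.reachable]
    obtain ⟨w, hw⟩ := (hρ v).exists_walk_length_eq_dist
    rw [← hw]
    simpa using SimpleGraph.dist_le (w.concat huv.symm)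
  have hpar : ∀ v, ∃ u, (G.dist (ρ v) v ≠ 0 → G.Adj u v) ∧
      G.dist (ρ u) u = G.dist (ρ v) v - 1 ∧ (G.dist (ρ v) v = 0 → u = v) := by
    intro v
    by_cases h0 : G.dist (ρ v) v = 0
    · exact ⟨v, fun h => absurd h0 h, by omega, fun _ => rfl⟩
    obtain ⟨w, hw⟩ := (hρ v).exists_walk_length_eq_dist
    obtain ⟨u, q, huv, hwq⟩ : ∃ u, ∃ q : G.Walk (ρ v) u, ∃ h : G.Adj u v, w = q.concat h := by
      generalize ρ v = y at w h0 hw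
      cases w with
      | nil => exact absurd hw.symm h0
      | cons h w =>
        obtain ⟨x, q, h', e⟩ := SimpleGraph.Walk.exists_cons_eq_concat h w
        exact ⟨x, q, h', e⟩
    refine ⟨u, fun _ => huv, ?_, fun h => absurd h h0⟩
    have h1 : w.length = q.length + 1 := by rw [hwq, SimpleGraph.Walk.length_concat]
    have h2 : G.dist (ρ u) u ≤ q.length :=
      (congrArg (G.dist · u) (hρe u v huv.reachable)).le.trans (SimpleGraph.dist_le q)
    have h3 := hadj v u huv.symm
    omega
  choose p hp using hpar
  refine ⟨fun v => G.dist (ρ v) v, p, fun v => (hp v).1, fun v => (hp v).2.1,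
    fun v => (hp v).2.2, ?_, hadj⟩
  intro u v huv hu hv
  rw [← (hρ u).dist_eq_zero_iff.1 hu, ← (hρ v).dist_eq_zero_iff.1 hv, hρe u v huv]

variable [Fintype V]

theorem exists_isChop (G : SimpleGraph V) {ℓ : ℕ} (hℓ : 0 < ℓ) :
    ∃ G', IsChop ℓ G G' ∧ ℓ * (G.edgeSet \ G'.edgeSet).ncard ≤ G.edgeSet.ncard := by
  classical
  obtain ⟨L, p, hL⟩ := exists_isLayering G
  let cut : ℕ → Sym2 V → Prop := fun s e =>
    ∃ u v, e = s(u, v) ∧ L v = L u + 1 ∧ ℓ ∣ L v + s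
  have hsum : ∑ s ∈ range ℓ, #(G.edgeFinset.filter (cut s)) ≤ #G.edgeFinset := by
    have := sum_card_bipartiteAbove_eq_sum_card_bipartiteBelow cut
      (s := range ℓ) (t := G.edgeFinset)
    unfold bipartiteAbove bipartiteBelow at this
    rw [this, card_eq_sum_ones]
    refine sum_le_sum fun e _ => card_le_one.2 ?_
    intro s hs s' hs'
    simp only [mem_filter, mem_range] at hs hs'
    obtain ⟨hs, u, v, rfl, huv, hd⟩ := hs
    obtain ⟨hs', u', v', he, huv', hd'⟩ := hs'
    have hv : v = v' := by
      rcases Sym2.eq_iff.1 he with h | ⟨rfl, rfl⟩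
      · exact h.2
      · omega
    subst hv
    have h1 : L v + s ≡ L v + s' [MOD ℓ] :=
      ((Nat.modEq_zero_iff_dvd.2 hd).trans (Nat.modEq_zero_iff_dvd.2 hd').symm)
    have h2 := Nat.ModEq.add_left_cancel' _ h1
    exact Nat.ModEq.eq_of_lt_of_lt h2 hs hs'
  obtain ⟨s, -, hs⟩ : ∃ s ∈ range ℓ, ℓ * #(G.edgeFinset.filter (cut s)) ≤ #G.edgeFinset := by
    refine exists_le_of_sum_le (nonempty_range_iff.2 hℓ.ne') ?_
    rw [← mul_sum, sum_const, card_range, smul_eq_mul]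
    exact Nat.mul_le_mul_left _ hsum
  refine ⟨{ Adj := fun u v => G.Adj u v ∧ (L u + s) / ℓ = (L v + s) / ℓ,
            symm := ⟨fun u v h => ⟨h.1.symm, h.2.symm⟩⟩,
            loopless := ⟨fun u h => G.loopless.irrefl u h.1⟩ },
    ⟨L, p, s, hL, fun u v => Iff.rfl⟩, ?_⟩
  have hE : G.edgeSet.ncard = #G.edgeFinset := by
    rw [← SimpleGraph.coe_edgeFinset, Set.ncard_coe_finset]
  rw [hE]
  refine le_trans (Nat.mul_le_mul_left _ ?_) hs
  rw [← Set.ncard_coe_finset]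
  refine Set.ncard_le_ncard ?_ (Set.toFinite _)
  rintro e ⟨he, he'⟩
  rw [mem_coe, mem_filter]
  refine ⟨SimpleGraph.mem_edgeFinset.2 he, ?_⟩
  induction e with | _ u v =>
  rw [SimpleGraph.mem_edgeSet] at he he'
  have hne : (L u + s) / ℓ ≠ (L v + s) / ℓ := fun h => he' ⟨he, h⟩
  have key : ∀ u v, G.Adj u v → (L u + s) / ℓ ≠ (L v + s) / ℓ → L u ≤ L v →
      L v = L u + 1 ∧ ℓ ∣ L v + s := by
    intro u v huv hne hle
    have h1 := hL.level_le v u huv.symm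
    have h2 : L v = L u + 1 := by
      rcases Nat.lt_or_ge (L u) (L v) with h | h
      · omega
      · rw [le_antisymm hle h] at hne; exact absurd rfl hne
    refine ⟨h2, ?_⟩
    by_contra hd
    rw [h2, add_right_comm] at hne hd
    rw [Nat.succ_div, if_neg hd] at hne
    exact hne rfl
  rcases le_total (L u) (L v) with h | h
  · exact ⟨u, v, rfl, key u v he hne h⟩
  · exact ⟨v, u, Sym2.eq_swap, key v u he.symm hne.symm h⟩

theorem exists_isIteratedChop (r : ℕ) (G : SimpleGraph V) {ℓ : ℕ} (hℓ : 0 < ℓ) :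
    ∃ G', IsIteratedChop ℓ r G G' ∧
      ℓ * (G.edgeSet \ G'.edgeSet).ncard ≤ r * G.edgeSet.ncard := by
  induction r generalizing G with
  | zero => exact ⟨G, .zero G, by simp⟩
  | succ r ih =>
    obtain ⟨G₁, h₁, hc₁⟩ := exists_isChop G hℓ
    obtain ⟨G₂, h₂, hc₂⟩ := ih G₁
    refine ⟨G₂, .succ h₁ h₂, ?_⟩
    have hsub : G.edgeSet \ G₂.edgeSet ⊆
        (G.edgeSet \ G₁.edgeSet) ∪ (G₁.edgeSet \ G₂.edgeSet) := by
      intro e he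
      by_cases h : e ∈ G₁.edgeSet
      · exact Or.inr ⟨h, he.2⟩
      · exact Or.inl ⟨he.1, h⟩
    have h3 := (Set.ncard_le_ncard hsub (Set.toFinite _)).trans (Set.ncard_union_le _ _)
    have h4 : G₁.edgeSet.ncard ≤ G.edgeSet.ncard :=
      Set.ncard_le_ncard (SimpleGraph.edgeSet_mono h₁.le) (Set.toFinite _)
    calc ℓ * (G.edgeSet \ G₂.edgeSet).ncard
        ≤ ℓ * ((G.edgeSet \ G₁.edgeSet).ncard + (G₁.edgeSet \ G₂.edgeSet).ncard) :=
          Nat.mul_le_mul_left _ h3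
      _ ≤ G.edgeSet.ncard + r * G₁.edgeSet.ncard := by rw [mul_add]; exact add_le_add hc₁ hc₂
      _ ≤ G.edgeSet.ncard + r * G.edgeSet.ncard :=
          Nat.add_le_add_left (Nat.mul_le_mul_left _ h4) _
      _ = (r + 1) * G.edgeSet.ncard := by ring

open Classical in
theorem card_near_le (G : SimpleGraph V) {D : ℕ} (hD : ∀ v, G.degree v ≤ D) (k : ℕ) (v : V) :
    #{u | Near G k v u} ≤ (D + 1) ^ k := by
  induction k generalizing v with
  | zero =>
    rw [pow_zero]
    refine card_le_one.2 ?_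
    have : ∀ u, Near G 0 v u → v = u := fun u ⟨w, hw⟩ =>
      SimpleGraph.Walk.eq_of_length_eq_zero (Nat.le_zero.1 hw)
    intro a ha b hb
    rw [mem_filter] at ha hb
    rw [← this a ha.2, ← this b hb.2]
  | succ k ih =>
    have hsub : ({u | Near G (k + 1) v u} : Finset V) ⊆
        {v} ∪ (G.neighborFinset v).biUnion fun w => {u | Near G k w u} := by
      intro u hu
      obtain ⟨-, p, hp⟩ := mem_filter.1 hu
      cases p with
      | nil => exact mem_union_left _ (mem_singleton_self _)
      | cons h q =>
        refine mem_union_right _ (mem_biUnion.2 ⟨_, (SimpleGraph.mem_neighborFinset _ _ _).2 h, ?_⟩)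
        rw [SimpleGraph.Walk.length_cons] at hp
        exact mem_filter.2 ⟨mem_univ _, q, by omega⟩
    calc _ ≤ 1 + #(G.neighborFinset v) * (D + 1) ^ k :=
          (card_le_card hsub).trans ((card_union_le _ _).trans (add_le_add (card_singleton v).le
            (card_biUnion_le_card_mul _ _ _ fun w _ => ih w)))
      _ ≤ 1 + D * (D + 1) ^ k := by
          have := hD v
          rw [← SimpleGraph.card_neighborFinset_eq_degree] at this
          gcongr
      _ ≤ (D + 1) ^ (k + 1) := by
          have : 0 < (D + 1) ^ k := by positivity
          rw [pow_succ]; nlinarith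

theorem exists_pairwise_not_near (G : SimpleGraph V) {D k : ℕ} [DecidableRel G.Adj]
    (hD : ∀ v, G.degree v ≤ D) (K : Finset V) (m : ℕ) (hK : m * (D + 1) ^ k < #K) :
    ∃ x : Fin m → V, (∀ i, x i ∈ K) ∧ ∀ i j, i ≠ j → ¬ Near G k (x i) (x j) := by
  classical
  induction m with
  | zero => exact ⟨fun i => i.elim0, fun i => i.elim0, fun i => i.elim0⟩
  | succ m ih =>
    rw [Nat.succ_mul] at hK
    obtain ⟨x, hx, hfar⟩ := ih (by omega)
    obtain ⟨y, hy, hy'⟩ := exists_mem_notMem_of_card_lt_card (s := univ.biUnion fun i : Fin m =>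
      ({u | Near G k (x i) u} : Finset V)) (t := K) (by
        have := card_biUnion_le_card_mul univ (fun i : Fin m =>
          ({u | Near G k (x i) u} : Finset V)) ((D + 1) ^ k) (fun i _ => by
            convert card_near_le G (D := D) (fun v => ?_) k (x i)
            convert hD v)
        rw [card_univ, Fintype.card_fin] at this
        omega)
    have hy'' : ∀ i, ¬ Near G k (x i) y := fun i hi =>
      hy' (mem_biUnion.2 ⟨i, mem_univ _, mem_filter.2 ⟨mem_univ _, hi⟩⟩)
    refine ⟨Fin.cons y x, Fin.cases hy hx, ?_⟩
    intro i j
    refine Fin.cases ?_ (fun i => ?_) i <;> refine Fin.cases ?_ (fun j => ?_) j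
    · exact fun h => absurd rfl h
    · exact fun _ h => hy'' j h.symm
    · exact fun _ => hy'' i
    · exact fun h => hfar i j fun h' => h (congrArg _ h')

/-- Minor-free graphs with few edges can be split into bounded pieces by removing few vertices. -/
theorem exists_small_pieces {W : Type*} [Fintype W] (H : SimpleGraph W) (G : SimpleGraph V)
    (hfree : ¬ IsMinorOf H G) {ℓ : ℕ} (hℓ : 0 < ℓ) :
    ∃ (X : Finset V) (c : V → Set V),
      (∀ u v, G.Adj u v → u ∉ X → v ∉ X → c u = c v) ∧
      (∀ a, {v | c v = a}.ncard ≤ (Fintype.card W + 2) *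
        (ℓ + 1) ^ (14 * ℓ + 2 * (Fintype.card W * (6 * ℓ)))) ∧
      ℓ * #X ≤ (Fintype.card W + 2) * G.edgeSet.ncard := by
  classical
  set r := Fintype.card W with hr
  set k := 14 * ℓ + 2 * (r * (6 * ℓ)) with hk
  let Y : Finset V := {v | ℓ < G.degree v}
  let G₀ : SimpleGraph V :=
    { Adj := fun u v => G.Adj u v ∧ u ∉ Y ∧ v ∉ Y
      symm := ⟨fun u v h => ⟨h.1.symm, h.2.2, h.2.1⟩⟩
      loopless := ⟨fun u h => G.loopless.irrefl u h.1⟩ }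
  have hG₀ : G₀ ≤ G := fun u v h => h.1
  have hdeg : ∀ v, G₀.degree v ≤ ℓ := by
    intro v
    by_cases hv : v ∈ Y
    · have : G₀.degree v = 0 := by
        rw [← SimpleGraph.card_neighborFinset_eq_degree, card_eq_zero, eq_empty_iff_forall_notMem]
        exact fun w h => ((SimpleGraph.mem_neighborFinset _ _ _).1 h).2.1 hv
      omega
    · have h1 : G.degree v ≤ ℓ := not_lt.1 fun h => hv (mem_filter.2 ⟨mem_univ _, h⟩)
      exact (SimpleGraph.degree_le_of_le hG₀).trans h1
  have hE : G.edgeSet.ncard = #G.edgeFinset := by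
    rw [← SimpleGraph.coe_edgeFinset, Set.ncard_coe_finset]
  have hY : ℓ * #Y ≤ 2 * G.edgeSet.ncard := by
    rw [hE, ← SimpleGraph.sum_degrees_eq_twice_card_edges, mul_comm, ← smul_eq_mul]
    refine (card_nsmul_le_sum Y _ ℓ fun v hv => (mem_filter.1 hv).2.le).trans ?_
    exact sum_le_sum_of_subset (subset_univ _)
  obtain ⟨G₁, hchop, hcut⟩ := exists_isIteratedChop r G₀ hℓ
  have hcut' : ℓ * (G₀.edgeSet \ G₁.edgeSet).ncard ≤ r * G.edgeSet.ncard :=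
    hcut.trans (Nat.mul_le_mul_left _
      (Set.ncard_le_ncard (SimpleGraph.edgeSet_mono hG₀) (Set.toFinite _)))
  let Z : Finset V := (G₀.edgeSet \ G₁.edgeSet).toFinset.image fun e => e.out.1
  have hZ : #Z ≤ (G₀.edgeSet \ G₁.edgeSet).ncard := by
    rw [Set.ncard_eq_toFinset_card']
    exact card_image_le
  refine ⟨Y ∪ Z, fun v => {u | G₁.Reachable v u}, ?_, ?_, ?_⟩
  · intro u v huv hu hv
    rw [mem_union, not_or] at hu hv
    have h0 : G₀.Adj u v := ⟨huv, hu.1, hv.1⟩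
    have h1 : G₁.Adj u v := by
      by_contra h1
      have hmem : s(u, v) ∈ (G₀.edgeSet \ G₁.edgeSet).toFinset := by
        rw [Set.mem_toFinset]
        exact ⟨h0, h1⟩
      have hZm : (s(u, v)).out.1 ∈ Z := mem_image_of_mem (fun e : Sym2 V => e.out.1) hmem
      rcases Sym2.mem_iff.1 (Sym2.out_fst_mem s(u, v)) with h | h
      · exact hu.2 (h ▸ hZm)
      · exact hv.2 (h ▸ hZm)
    ext w
    exact ⟨fun h => h1.symm.reachable.trans h, fun h => h1.reachable.trans h⟩
  · intro a
    by_contra! hcon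
    rw [Set.ncard_eq_toFinset_card'] at hcon
    obtain ⟨x, hx, hfar⟩ := exists_pairwise_not_near G₀ hdeg _ (r + 2) hcon
    have hreach : ∀ i j, G₁.Reachable (x i) (x j) := by
      intro i j
      have hi := hx i
      have hj := hx j
      rw [Set.mem_toFinset] at hi hj
      have hij : {u | G₁.Reachable (x i) u} = {u | G₁.Reachable (x j) u} :=
        Eq.trans (Set.mem_ofPred_eq ▸ hi) (Set.mem_ofPred_eq ▸ hj).symm
      have : x j ∈ {u | G₁.Reachable (x j) u} := SimpleGraph.Reachable.refl _
      rw [← hij] at this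
      exact this
    have hmodel := hchop.hasAnchoredModel (G := G₀) hℓ le_rfl hreach (i₀ := 0) (j₀ := 1)
      (fun h => hfar 0 1 (by simp) (h.mono le_rfl (by omega)))
    have hminor := hmodel.isMinorOf
      (fun i j hij h => hfar i j hij (h.mono le_rfl (by omega))) H
      (Fintype.equivFin W) (Fintype.equivFin W).injective
      (fun w => Fin.castAdd 2 (Fintype.equivFin W w))
      ((Fin.castAdd_injective _ _).comp (Fintype.equivFin W).injective)
    obtain ⟨μ, h1, h2, h3, h4⟩ := hminor
    refine hfree ⟨μ, h1, fun w => (h2 w).mono fun u v h => hG₀ h, h3, fun w₁ w₂ hw => ?_⟩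
    obtain ⟨u, hu, v, hv, huv⟩ := h4 hw
    exact ⟨u, hu, v, hv, hG₀ huv⟩
  · calc ℓ * #(Y ∪ Z) ≤ ℓ * (#Y + (G₀.edgeSet \ G₁.edgeSet).ncard) :=
          Nat.mul_le_mul_left _ ((card_union_le _ _).trans (Nat.add_le_add_left hZ _))
      _ ≤ (r + 2) * G.edgeSet.ncard := by rw [mul_add, add_mul]; omega

end Decomposition

section Counting

open Finset

variable {V : Type*} [Fintype V]

open Classical in
/-- A small vertex set all of whose nonempty subsets fail to be `t`-islands touches many edges. -/
theorem mul_card_le_card_touching (G : SimpleGraph V) {t M : ℕ}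
    (hno : ∀ S : Set V, IsIsland G t S → M < S.ncard) (K : Finset V) (hK : #K ≤ M) :
    t * #K ≤ #{e ∈ G.edgeFinset | ∃ v ∈ K, v ∈ e} := by
  induction hn : #K generalizing K with
  | zero => simp
  | succ n ih =>
    obtain ⟨v, hv, hvt⟩ : ∃ v ∈ K, t ≤ (G.neighborSet v \ K).ncard := by
      by_contra! hcon
      have := hno K ⟨card_pos.1 (by omega), hcon⟩
      rw [Set.ncard_coe_finset] at this
      omega
    have hcard := card_erase_of_mem hv
    have hih := ih (K.erase v) (by omega) (by omega)
    let F : Finset (Sym2 V) := (G.neighborFinset v \ K).image fun w => s(v, w)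
    have hF : t ≤ #F := by
      rw [card_image_of_injective _ (fun a b h => Sym2.congr_right.1 h)]
      rw [← Set.ncard_coe_finset]
      simpa using hvt
    have hdisj : Disjoint {e ∈ G.edgeFinset | ∃ u ∈ K.erase v, u ∈ e} F := by
      rw [Finset.disjoint_left]
      intro e he heF
      obtain ⟨-, u, hu, hue⟩ := mem_filter.1 he
      obtain ⟨w, hw, rfl⟩ := mem_image.1 heF
      rcases Sym2.mem_iff.1 hue with rfl | rfl
      · exact (mem_erase.1 hu).1 rfl
      · exact (mem_sdiff.1 hw).2 (mem_erase.1 hu).2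
    have hsub : {e ∈ G.edgeFinset | ∃ u ∈ K.erase v, u ∈ e} ∪ F ⊆
        {e ∈ G.edgeFinset | ∃ u ∈ K, u ∈ e} := by
      refine union_subset (fun e he => ?_) (fun e he => ?_)
      · obtain ⟨he, u, hu, hue⟩ := mem_filter.1 he
        exact mem_filter.2 ⟨he, u, (mem_erase.1 hu).2, hue⟩
      · obtain ⟨w, hw, rfl⟩ := mem_image.1 he
        have hvw := (SimpleGraph.mem_neighborFinset _ _ _).1 (mem_sdiff.1 hw).1
        exact mem_filter.2 ⟨SimpleGraph.mem_edgeFinset.2 hvw, v, hv, Sym2.mem_mk_left _ _⟩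
    have := card_le_card hsub
    rw [card_union_of_disjoint hdisj] at this
    rw [mul_add, mul_one]
    omega

theorem mul_card_le_of_pieces (G : SimpleGraph V) {t M : ℕ} {κ : Type*}
    (hno : ∀ S : Set V, IsIsland G t S → M < S.ncard) (X : Finset V) (c : V → κ)
    (hc : ∀ u v, G.Adj u v → u ∉ X → v ∉ X → c u = c v) (hM : ∀ a, {v | c v = a}.ncard ≤ M) :
    t * Fintype.card V ≤ G.edgeSet.ncard + t * #X := by
  classical
  have hE : G.edgeSet.ncard = #G.edgeFinset := by
    rw [← SimpleGraph.coe_edgeFinset, Set.ncard_coe_finset]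
  let K : κ → Finset V := fun a => {v ∈ Xᶜ | c v = a}
  let T : κ → Finset (Sym2 V) := fun a => {e ∈ G.edgeFinset | ∃ v ∈ K a, v ∈ e}
  have hKT : ∀ a, t * #(K a) ≤ #(T a) := by
    intro a
    refine mul_card_le_card_touching G hno (K a) (le_trans ?_ (hM a))
    rw [← Set.ncard_coe_finset]
    exact Set.ncard_le_ncard (fun v hv => (mem_filter.1 hv).2) (Set.toFinite _)
  have hdisj : ∀ a b, a ≠ b → Disjoint (T a) (T b) := by
    intro a b hab
    rw [Finset.disjoint_left]
    intro e hea heb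
    obtain ⟨he, u, hu, hue⟩ := mem_filter.1 hea
    obtain ⟨-, v, hv, hve⟩ := mem_filter.1 heb
    obtain ⟨huX, rfl⟩ := mem_filter.1 hu
    obtain ⟨hvX, rfl⟩ := mem_filter.1 hv
    have huv : u ≠ v := fun h => hab (congrArg c h)
    rw [(Sym2.mem_and_mem_iff huv).1 ⟨hue, hve⟩] at he
    exact hab (hc u v (SimpleGraph.mem_edgeFinset.1 he) (mem_compl.1 huX) (mem_compl.1 hvX))
  have h1 : #Xᶜ = ∑ a ∈ univ.image c, #(K a) :=
    card_eq_sum_card_fiberwise fun v _ => mem_image_of_mem c (mem_univ v)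
  have h2 : t * #Xᶜ ≤ #G.edgeFinset := by
    rw [h1, mul_sum]
    refine (sum_le_sum fun a _ => hKT a).trans ?_
    rw [← card_biUnion fun a _ b _ hab => hdisj a b hab]
    exact card_le_card (biUnion_subset.2 fun a _ => filter_subset _ _)
  have h3 := card_add_card_compl X
  rw [hE, ← h3, mul_add]
  omega

end Counting

/-- if `𝒢` is subgraph-closed, `H`-minor-free, and has edge density at most
`d·n + o(n)`, then there is `C ≥ 1` such that every non-empty graph in `𝒢` contains a
`⌊d+1⌋`-island of size at most `C`; i.e. `col_⋆(𝒢) ≤ ⌊d+1⌋`. -/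
theorem stmt10 {W : Type} [Fintype W] (H : SimpleGraph W)
    (𝒢 : ∀ n : ℕ, SimpleGraph (Fin n) → Prop) (hclosed : SubgraphClosed 𝒢)
    (hfree : ∀ (n : ℕ) (G : SimpleGraph (Fin n)), 𝒢 n G → ¬ IsMinorOf H G)
    (d : ℝ) (hd : 0 < d) (g : ℕ → ℝ)
    (hg : Filter.Tendsto (fun n : ℕ => g n / n) Filter.atTop (nhds 0))
    (hdens : ∀ (n : ℕ) (G : SimpleGraph (Fin n)), 𝒢 n G →
      (G.edgeSet.ncard : ℝ) ≤ d * n + g n) :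
    ∃ C : ℕ, 1 ≤ C ∧ ∀ (n : ℕ) (G : SimpleGraph (Fin n)), 𝒢 n G → 0 < n →
      ∃ S : Set (Fin n), IsIsland G (⌊d + 1⌋₊) S ∧ S.ncard ≤ C := by
  classical
  have hfloor : (⌊d + 1⌋₊ : ℝ) > d := by
    have := Nat.lt_floor_add_one (d + 1)
    linarith
  set t : ℕ := ⌊d + 1⌋₊ with ht
  set r : ℕ := Fintype.card W
  set γ : ℝ := min 1 (((t : ℝ) - d) / 4) with hγ
  have hγ0 : 0 < γ := lt_min one_pos (by linarith)
  have hγ1 : γ ≤ 1 := min_le_left _ _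
  have hγ4 : 4 * γ ≤ t - d := by
    have : γ ≤ ((t : ℝ) - d) / 4 := min_le_right _ _
    linarith
  obtain ⟨N, hN⟩ : ∃ N : ℕ, ∀ n ≥ N, 0 < n → g n ≤ γ * n := by
    obtain ⟨N, hN⟩ := Filter.eventually_atTop.1 (hg.eventually (gt_mem_nhds hγ0))
    refine ⟨N, fun n hn h0 => ?_⟩
    exact ((div_lt_iff₀ (Nat.cast_pos.2 h0)).1 (hN n hn)).le
  obtain ⟨ℓ, hℓ⟩ := exists_nat_gt ((t : ℝ) * (r + 2) * (d + 1) / γ)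
  have hℓ0 : 0 < ℓ := by
    have : (0 : ℝ) ≤ (t : ℝ) * (r + 2) * (d + 1) / γ := by positivity
    exact_mod_cast this.trans_lt hℓ
  rw [div_lt_iff₀ hγ0] at hℓ
  set M : ℕ := (r + 2) * (ℓ + 1) ^ (14 * ℓ + 2 * (r * (6 * ℓ)))
  refine ⟨N + M + 1, by omega, fun n G hG hn => ?_⟩
  by_contra! hcon
  have hnN : N ≤ n := by
    by_contra! hlt
    have htpos : 0 < t := by exact_mod_cast hd.trans hfloor
    have := hcon Set.univ ⟨⟨⟨0, hn⟩, trivial⟩, fun v _ => by simpa using htpos⟩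
    rw [Set.ncard_univ, Nat.card_eq_fintype_card, Fintype.card_fin] at this
    omega
  obtain ⟨X, c, hc, hM, hX⟩ := exists_small_pieces H G (hfree n G hG) hℓ0
  have hcount := mul_card_le_of_pieces G (t := t) (M := M)
    (fun S hS => by have := hcon S hS; omega) X c hc hM
  rw [Fintype.card_fin] at hcount
  have hE : (G.edgeSet.ncard : ℝ) ≤ d * n + γ * n := (hdens n G hG).trans
    (by linarith [hN n hnN hn])
  have hn' : (0 : ℝ) < n := Nat.cast_pos.2 hn
  have hcount' : (t : ℝ) * n ≤ G.edgeSet.ncard + t * X.card := by exact_mod_cast hcount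
  have hX' : (ℓ : ℝ) * X.card ≤ (r + 2) * G.edgeSet.ncard := by exact_mod_cast hX
  have hXn : (t : ℝ) * X.card ≤ γ * n := by
    have hℓ' : (0 : ℝ) < ℓ := Nat.cast_pos.2 hℓ0
    refine le_of_mul_le_mul_left ?_ hℓ'
    calc (ℓ : ℝ) * (t * X.card) = t * (ℓ * X.card) := by ring
      _ ≤ t * ((r + 2) * ((d + 1) * n)) := by
          refine mul_le_mul_of_nonneg_left (hX'.trans ?_) (Nat.cast_nonneg _)
          refine mul_le_mul_of_nonneg_left (hE.trans ?_) (by positivity)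
          nlinarith
      _ = t * (r + 2) * (d + 1) * n := by ring
      _ ≤ ℓ * γ * n := mul_le_mul_of_nonneg_right hℓ.le hn'.le
      _ = ℓ * (γ * n) := by ring
  nlinarith
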